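/- Let p ≥ 1, let λ = (λ₁,…,λ_p) be nonincreasing nonnegative weights with 1 ≥ λ₁ > 0, let x ∈ ℝ^p be nonzero, and fix δ > 0. Then there exist constants C > 0, c > 0 and σ₀ > 0 such that for every σ_z ≥ σ₀, the optimally tuned asymptotic MSE satisfies | δ(σ*(σ_z)² − σ_z²) − ‖x‖₂²/p | ≤ C·exp(−c·σ_z²). In particular, δ(σ*(σ_z)² − σ_z²) = ‖x‖₂²/p + O(exp(−c σ_z²)) as σ_z → ∞. -/

import Mathlib

open MeasureTheory ProbabilityTheory Filter

/-- Standard Gaussian measure `N(0, I_n)` on `ℝⁿ`. -/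
noncomputable def stdGaussian (n : ℕ) : Measure (Fin n → ℝ) :=
  Measure.pi fun _ => gaussianReal 0 1

/-- The nonincreasing rearrangement of the absolute values of the entries of `x`. -/
noncomputable def sortedAbs {n : ℕ} (x : Fin n → ℝ) : Fin n → ℝ :=
  fun i => |x ((Tuple.sort fun j => -|x j|) i)|

/-- The sorted-ℓ1 (SLOPE) norm `‖x‖_λ = ∑ λ_i |x|_(i)`. -/
noncomputable def slopeNorm {n : ℕ} (lam x : Fin n → ℝ) : ℝ :=
  ∑ i, lam i * sortedAbs x i

/-- The SLOPE proximal objective `½‖u − v‖₂² + γ‖v‖_λ`. -/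
noncomputable def slopeObj {n : ℕ} (lam : Fin n → ℝ) (γ : ℝ) (u v : Fin n → ℝ) : ℝ :=
  (1/2) * ∑ i, (u i - v i)^2 + γ * slopeNorm lam v

/-- `v` is a minimizer of the SLOPE proximal objective, i.e. `v = η(u; γ, λ)`
(the minimizer is unique since the objective is strictly convex). -/
def IsSlopeProx {n : ℕ} (lam : Fin n → ℝ) (γ : ℝ) (u v : Fin n → ℝ) : Prop :=
  ∀ w, slopeObj lam γ u v ≤ slopeObj lam γ u w

theorem sq_dotProduct_le {n : ℕ} (a b : Fin n → ℝ) : (a ⬝ᵥ b) ^ 2 ≤ (a ⬝ᵥ a) * (b ⬝ᵥ b) := by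
  simpa [dotProduct, pow_two] using Finset.sum_mul_sq_le_sq_mul_sq Finset.univ a b

section SlopeNorm

variable {n : ℕ} {lam : Fin n → ℝ}

theorem antitone_sortedAbs (x : Fin n → ℝ) : Antitone (sortedAbs x) := by
  intro i j hij
  have h := Tuple.monotone_sort (fun j => -|x j|) hij
  simpa [sortedAbs] using h

theorem sum_mul_abs_perm_le_slopeNorm (hlam : Antitone lam) (x : Fin n → ℝ)
    (π : Equiv.Perm (Fin n)) : ∑ i, lam i * |x (π i)| ≤ slopeNorm lam x := by
  set s := Tuple.sort fun j => -|x j| with hs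
  have hmv : Monovary lam (sortedAbs x) := hlam.monovary (antitone_sortedAbs x)
  have h := hmv.sum_mul_comp_perm_le_sum_mul (σ := π.trans s.symm)
  simpa [sortedAbs, slopeNorm, ← hs] using h

theorem slopeNorm_add_le (hlam : Antitone lam) (hnonneg : ∀ i, 0 ≤ lam i) (x y : Fin n → ℝ) :
    slopeNorm lam (x + y) ≤ slopeNorm lam x + slopeNorm lam y := by
  set s := Tuple.sort fun j => -|(x + y) j| with hs
  calc slopeNorm lam (x + y) = ∑ i, lam i * |x (s i) + y (s i)| := rfl
    _ ≤ ∑ i, (lam i * |x (s i)| + lam i * |y (s i)|) := by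
        refine Finset.sum_le_sum fun i _ => ?_
        rw [← mul_add]
        exact mul_le_mul_of_nonneg_left (abs_add_le _ _) (hnonneg i)
    _ ≤ _ := by
        rw [Finset.sum_add_distrib]
        exact add_le_add (sum_mul_abs_perm_le_slopeNorm hlam x s)
          (sum_mul_abs_perm_le_slopeNorm hlam y s)

theorem slopeNorm_neg (x : Fin n → ℝ) : slopeNorm lam (-x) = slopeNorm lam x := by
  simp [slopeNorm, sortedAbs]

theorem slopeNorm_smul_le (hlam : Antitone lam) (x : Fin n → ℝ) {c : ℝ} (hc : 0 ≤ c) :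
    slopeNorm lam (c • x) ≤ c * slopeNorm lam x := by
  set s := Tuple.sort fun j => -|(c • x) j| with hs
  calc slopeNorm lam (c • x) = ∑ i, lam i * |c * x (s i)| := rfl
    _ = c * ∑ i, lam i * |x (s i)| := by
        rw [Finset.mul_sum]
        refine Finset.sum_congr rfl fun i _ => ?_
        rw [abs_mul, abs_of_nonneg hc]; ring
    _ ≤ _ := mul_le_mul_of_nonneg_left (sum_mul_abs_perm_le_slopeNorm hlam x s) hc

theorem slopeNorm_zero : slopeNorm lam 0 = 0 := by
  simp [slopeNorm, sortedAbs]

theorem mul_abs_le_slopeNorm (hlam : Antitone lam) (hnonneg : ∀ i, 0 ≤ lam i)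
    (x : Fin n → ℝ) (i j : Fin n) : lam i * |x j| ≤ slopeNorm lam x := by
  refine le_trans ?_ (sum_mul_abs_perm_le_slopeNorm hlam x (Equiv.swap i j))
  have h := Finset.single_le_sum (f := fun k => lam k * |x (Equiv.swap i j k)|)
    (fun k _ => mul_nonneg (hnonneg k) (abs_nonneg _)) (Finset.mem_univ i)
  simpa using h

end SlopeNorm

section Prox

variable {n : ℕ} {lam : Fin n → ℝ} {γ : ℝ} {u u' q q' : Fin n → ℝ}

/-- First-order optimality conditions of the SLOPE proximal problem: `u - q` lies in `γ` times
the dual unit ball, and attains the support function of that set at `q`. -/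
def SlopeOptimality (lam : Fin n → ℝ) (γ : ℝ) (u q : Fin n → ℝ) : Prop :=
  (u - q) ⬝ᵥ q = γ * slopeNorm lam q ∧ ∀ y, (u - q) ⬝ᵥ y ≤ γ * slopeNorm lam y

theorem IsSlopeProx.dotProduct_sub_le (hlam : Antitone lam) (hnonneg : ∀ i, 0 ≤ lam i)
    (hγ : 0 ≤ γ) (h : IsSlopeProx lam γ u q) (y : Fin n → ℝ) :
    (u - q) ⬝ᵥ (y - q) ≤ γ * slopeNorm lam y - γ * slopeNorm lam q := by
  set D := (y - q) ⬝ᵥ (y - q) with hD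
  have hstep : ∀ ε ∈ Set.Ioo (0 : ℝ) 1, (u - q) ⬝ᵥ (y - q)
      ≤ γ * slopeNorm lam y - γ * slopeNorm lam q + ε * (D / 2) := by
    rintro ε ⟨hε0, hε1⟩
    have hw := h ((1 - ε) • q + ε • y)
    have hconv : slopeNorm lam ((1 - ε) • q + ε • y)
        ≤ (1 - ε) * slopeNorm lam q + ε * slopeNorm lam y :=
      (slopeNorm_add_le hlam hnonneg _ _).trans (add_le_add
        (slopeNorm_smul_le hlam _ (by linarith)) (slopeNorm_smul_le hlam _ hε0.le))
    have hexp : ∑ i, (u i - ((1 - ε) • q + ε • y) i) ^ 2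
        = ∑ i, (u i - q i) ^ 2 - 2 * ε * ((u - q) ⬝ᵥ (y - q)) + ε ^ 2 * D := by
      simp only [hD, dotProduct, Finset.mul_sum, ← Finset.sum_sub_distrib,
        ← Finset.sum_add_distrib]
      refine Finset.sum_congr rfl fun i _ => ?_
      simp only [Pi.add_apply, Pi.smul_apply, Pi.sub_apply, smul_eq_mul]; ring
    unfold slopeObj at hw
    rw [hexp] at hw
    have hmul := mul_le_mul_of_nonneg_left hconv hγ
    refine le_of_mul_le_mul_left ?_ hε0
    nlinarith
  have hlim : Tendsto (fun ε : ℝ => γ * slopeNorm lam y - γ * slopeNorm lam q + ε * (D / 2))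
      (nhdsWithin 0 (Set.Ioi 0)) (nhds (γ * slopeNorm lam y - γ * slopeNorm lam q)) := by
    have hc : Continuous fun ε : ℝ =>
      γ * slopeNorm lam y - γ * slopeNorm lam q + ε * (D / 2) := by fun_prop
    simpa using (hc.tendsto 0).mono_left nhdsWithin_le_nhds
  refine ge_of_tendsto hlim ?_
  filter_upwards [Ioo_mem_nhdsGT (zero_lt_one' ℝ)] with ε hε using hstep ε hε

theorem IsSlopeProx.optimality (hlam : Antitone lam) (hnonneg : ∀ i, 0 ≤ lam i)
    (hγ : 0 ≤ γ) (h : IsSlopeProx lam γ u q) : SlopeOptimality lam γ u q := by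
  have hv := h.dotProduct_sub_le hlam hnonneg hγ
  have h0 := hv 0
  have h2 := hv ((2 : ℝ) • q)
  have hN2 := mul_le_mul_of_nonneg_left (slopeNorm_smul_le hlam q (zero_le_two (α := ℝ))) hγ
  rw [slopeNorm_zero] at h0
  simp only [dotProduct_sub, dotProduct_smul, dotProduct_zero, smul_eq_mul] at h0 h2
  have heq : (u - q) ⬝ᵥ q = γ * slopeNorm lam q := by linarith
  refine ⟨heq, fun y => ?_⟩
  have hy := hv y
  rw [dotProduct_sub] at hy
  linarith

namespace SlopeOptimality

theorem firmly_nonexpansive (h : SlopeOptimality lam γ u q) (h' : SlopeOptimality lam γ u' q') :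
    (q - q') ⬝ᵥ (q - q') ≤ (u - u') ⬝ᵥ (q - q') := by
  have h1 := h.2 q'
  have h2 := h'.2 q
  rw [← h'.1] at h1
  rw [← h.1] at h2
  simp only [sub_dotProduct, dotProduct_sub] at *
  linarith

theorem nonexpansive (h : SlopeOptimality lam γ u q) (h' : SlopeOptimality lam γ u' q') :
    (q - q') ⬝ᵥ (q - q') ≤ (u - u') ⬝ᵥ (u - u') := by
  have h1 := h.firmly_nonexpansive h'
  have h2 : 0 ≤ ((u - u') - (q - q')) ⬝ᵥ ((u - u') - (q - q')) :=
    Finset.sum_nonneg fun i _ => mul_self_nonneg _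
  have h3 := dotProduct_comm (u - u') (q - q')
  rw [sub_dotProduct (u - u') (q - q'), dotProduct_sub _ (u - u') (q - q'),
    dotProduct_sub _ (u - u') (q - q')] at h2
  linarith

theorem unique (h : SlopeOptimality lam γ u q) (h' : SlopeOptimality lam γ u q') : q = q' := by
  have h1 := h.nonexpansive h'
  rw [sub_self u, dotProduct_zero] at h1
  have h2 : (q - q') ⬝ᵥ (q - q') = 0 :=
    le_antisymm h1 (Finset.sum_nonneg fun i _ => mul_self_nonneg _)
  exact sub_eq_zero.mp (dotProduct_self_eq_zero.mp h2)

theorem neg (h : SlopeOptimality lam γ u q) : SlopeOptimality lam γ (-u) (-q) := by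
  have hsub : -u - -q = -(u - q) := by abel
  refine ⟨?_, fun y => ?_⟩
  · rw [hsub, neg_dotProduct_neg, slopeNorm_neg]; exact h.1
  · rw [hsub, neg_dotProduct, ← dotProduct_neg, ← slopeNorm_neg y]; exact h.2 _

theorem zero_of_sum_abs_le (hlam : Antitone lam) (hnonneg : ∀ i, 0 ≤ lam i)
    (hγ : 0 ≤ γ) (i₀ : Fin n) (hu : ∑ i, |u i| ≤ γ * lam i₀) : SlopeOptimality lam γ u 0 := by
  refine ⟨by simp [slopeNorm_zero], fun y => ?_⟩
  obtain ⟨j, -, hj⟩ := Finset.exists_max_image Finset.univ (fun i => |y i|) ⟨i₀, Finset.mem_univ _⟩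
  calc (u - 0) ⬝ᵥ y = ∑ i, u i * y i := by simp [dotProduct]
    _ ≤ ∑ i, |u i| * |y j| := Finset.sum_le_sum fun i _ => by
        refine (le_abs_self _).trans ?_
        rw [abs_mul]
        exact mul_le_mul_of_nonneg_left (hj i (Finset.mem_univ _)) (abs_nonneg _)
    _ = (∑ i, |u i|) * |y j| := by rw [Finset.sum_mul]
    _ ≤ γ * lam i₀ * |y j| := mul_le_mul_of_nonneg_right hu (abs_nonneg _)
    _ ≤ γ * slopeNorm lam y := by
        rw [mul_assoc]
        exact mul_le_mul_of_nonneg_left (mul_abs_le_slopeNorm hlam hnonneg y i₀ j) hγ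

theorem zero (hnonneg : ∀ i, 0 ≤ lam i) (hγ : 0 ≤ γ) :
    SlopeOptimality lam γ 0 0 := by
  refine ⟨by simp [slopeNorm_zero], fun y => ?_⟩
  rw [sub_self, zero_dotProduct]
  exact mul_nonneg hγ (Finset.sum_nonneg fun i _ => mul_nonneg (hnonneg i) (abs_nonneg _))

/-- The distance to the dual ball grows at least linearly along its gradient. -/
theorem add_dotProduct_le (h : SlopeOptimality lam γ u q) (h' : SlopeOptimality lam γ u' q') :
    q ⬝ᵥ q + (u' - u) ⬝ᵥ q ≤ q' ⬝ᵥ q := by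
  have h2 := h'.2 q
  rw [← h.1] at h2
  simp only [sub_dotProduct] at *
  linarith

end SlopeOptimality

end Prox
section Gaussian

theorem gaussianPDF_le_shift {M t y : ℝ} (hMt : M * |t| ≤ 1) (ht : t ^ 2 ≤ 1) (hy : |y| ≤ M) :
    gaussianPDF 0 1 y ≤ ENNReal.ofReal (Real.exp 2) * gaussianPDF 0 1 (y + t) := by
  unfold gaussianPDF
  rw [← ENNReal.ofReal_mul (Real.exp_nonneg _)]
  refine ENNReal.ofReal_le_ofReal ?_
  have hyt : y * t ≤ 1 := by
    refine (le_abs_self _).trans ?_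
    rw [abs_mul]
    exact (mul_le_mul_of_nonneg_right hy (abs_nonneg t)).trans hMt
  simp only [gaussianPDFReal, sub_zero, NNReal.coe_one, mul_one]
  rw [mul_left_comm, ← Real.exp_add]
  refine mul_le_mul_of_nonneg_left (Real.exp_le_exp.mpr ?_) (by positivity)
  nlinarith

theorem lintegral_gaussianReal_shift_le {M t : ℝ} (hMt : M * |t| ≤ 1) (ht : t ^ 2 ≤ 1)
    {f : ℝ → ENNReal} (hf : Measurable f) :
    ∫⁻ y, {y : ℝ | |y| ≤ M}.indicator (fun y => f (y + t)) y ∂gaussianReal 0 1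
      ≤ ENNReal.ofReal (Real.exp 2) * ∫⁻ y, f y ∂gaussianReal 0 1 := by
  have hS : MeasurableSet {y : ℝ | |y| ≤ M} := measurableSet_le (by fun_prop) (by fun_prop)
  have hpdf : Measurable (gaussianPDF 0 1) := measurable_gaussianPDF 0 1
  have hft : Measurable ({y : ℝ | |y| ≤ M}.indicator fun y => f (y + t)) :=
    (hf.comp (measurable_add_const t)).indicator hS
  rw [gaussianReal_of_var_ne_zero 0 one_ne_zero,
    lintegral_withDensity_eq_lintegral_mul _ hpdf hft,
    lintegral_withDensity_eq_lintegral_mul _ hpdf hf,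
    ← lintegral_add_right_eq_self (gaussianPDF 0 1 * f) t,
    ← lintegral_const_mul (f := fun y => (gaussianPDF 0 1 * f) (y + t)) _
      ((hpdf.mul hf).comp (measurable_add_const t))]
  refine lintegral_mono fun y => ?_
  simp only [Pi.mul_apply]
  by_cases hy : y ∈ {y : ℝ | |y| ≤ M}
  · rw [Set.indicator_of_mem hy, ← mul_assoc]
    exact mul_le_mul_left (gaussianPDF_le_shift hMt ht hy) _
  · rw [Set.indicator_of_notMem hy, mul_zero]; exact zero_le

instance isProbabilityMeasure_stdGaussian_pi (n : ℕ) :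
    IsProbabilityMeasure (_root_.stdGaussian n) := by
  unfold _root_.stdGaussian; infer_instance

theorem lintegral_stdGaussian_shift_le {n : ℕ} {M t : ℝ} (hMt : M * |t| ≤ 1) (ht : t ^ 2 ≤ 1)
    (i : Fin n) {f : (Fin n → ℝ) → ENNReal} (hf : Measurable f) :
    ∫⁻ h, {h : Fin n → ℝ | |h i| ≤ M}.indicator (fun h => f (h + Pi.single i t)) h
        ∂_root_.stdGaussian n
      ≤ ENNReal.ofReal (Real.exp 2) * ∫⁻ h, f h ∂_root_.stdGaussian n := by
  have hS : MeasurableSet {h : Fin n → ℝ | |h i| ≤ M} :=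
    measurableSet_le (by fun_prop) (by fun_prop)
  have hg : Measurable ({h : Fin n → ℝ | |h i| ≤ M}.indicator
      fun h => f (h + Pi.single i t)) :=
    (hf.comp (measurable_id.add_const _)).indicator hS
  rw [← lintegral_const_mul _ hf]
  unfold _root_.stdGaussian
  rw [lintegral_eq_lmarginal_univ 0, lintegral_eq_lmarginal_univ 0,
    lmarginal_erase' _ hg (Finset.mem_univ i),
    lmarginal_erase' _ (hf.const_mul _) (Finset.mem_univ i)]
  refine lmarginal_mono (fun h => ?_) 0
  have hu : Measurable fun y : ℝ => f (Function.update h i y) :=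
    hf.comp (measurable_update h)
  refine le_trans (le_of_eq ?_) ((lintegral_gaussianReal_shift_le hMt ht hu).trans_eq
    (lintegral_const_mul _ hu).symm)
  refine lintegral_congr fun y => ?_
  have hadd : Function.update h i y + Pi.single i t = Function.update h i (y + t) := by
    ext j
    rcases eq_or_ne j i with rfl | hj
    · simp
    · simp [hj]
  simp [Set.indicator, hadd]

theorem measurePreserving_neg_stdGaussian (n : ℕ) :
    MeasurePreserving (fun h : Fin n → ℝ => -h) (_root_.stdGaussian n) (_root_.stdGaussian n) := by
  have h1 : MeasurePreserving (fun y : ℝ => -y) (gaussianReal 0 1) (gaussianReal 0 1) :=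
    ⟨measurable_neg, by simpa using gaussianReal_map_neg (μ := 0) (v := 1)⟩
  exact measurePreserving_pi _ _ fun _ => h1

theorem gaussianReal_abs_gt_le {M : ℝ} (hM : 0 ≤ M) :
    (gaussianReal 0 1).real {y : ℝ | M < |y|} ≤ 2 * Real.exp (-M ^ 2 / 2) := by
  have hint : ∀ t : ℝ, Integrable (fun y => Real.exp (t * id y)) (gaussianReal 0 1) :=
    fun t => integrable_exp_mul_gaussianReal t
  have h1 := measure_ge_le_exp_mul_mgf M hM (hint M)
  have h2 := measure_le_le_exp_mul_mgf (-M) (neg_nonpos.mpr hM) (hint (-M))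
  rw [mgf_id_gaussianReal, ← Real.exp_add] at h1 h2
  have e1 : -M * M + (0 * M + ((1 : NNReal) : ℝ) * M ^ 2 / 2) = -M ^ 2 / 2 := by
    push_cast; ring
  have e2 : -(-M) * (-M) + (0 * (-M) + ((1 : NNReal) : ℝ) * (-M) ^ 2 / 2) = -M ^ 2 / 2 := by
    push_cast; ring
  rw [e1] at h1
  rw [e2] at h2
  have hsub : {y : ℝ | M < |y|} ⊆ {y | M ≤ id y} ∪ {y | id y ≤ -M} := by
    intro y hy
    rcases lt_abs.mp (show M < |y| from hy) with h | h
    · exact Or.inl h.le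
    · exact Or.inr (show y ≤ -M by linarith)
  calc _ ≤ _ := measureReal_mono hsub
    _ ≤ _ := measureReal_union_le _ _
    _ ≤ _ := by linarith

theorem stdGaussian_exists_abs_gt_le {n : ℕ} {M : ℝ} (hM : 0 ≤ M) :
    (_root_.stdGaussian n).real {h : Fin n → ℝ | ∃ i, M < |h i|}
      ≤ n * (2 * Real.exp (-M ^ 2 / 2)) := by
  have hU : {h : Fin n → ℝ | ∃ i, M < |h i|} = ⋃ i, {h | M < |h i|} := by ext; simp
  rw [hU]
  refine (measureReal_iUnion_fintype_le _).trans ?_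
  refine (Finset.sum_le_sum fun i _ => ?_ : _ ≤ ∑ _i : Fin n, 2 * Real.exp (-M ^ 2 / 2)).trans_eq
    (by simp)
  refine le_trans (le_of_eq ?_) (gaussianReal_abs_gt_le hM)
  have hmp : MeasurePreserving (Function.eval i) (_root_.stdGaussian n) (gaussianReal 0 1) :=
    measurePreserving_eval (fun _ : Fin n => gaussianReal 0 1) i
  have hS : MeasurableSet {y : ℝ | M < |y|} := measurableSet_lt (by fun_prop) (by fun_prop)
  exact hmp.measureReal_preimage hS.nullMeasurableSet

theorem integrable_sq_add_mul_stdGaussian {n : ℕ} (a σ : ℝ) (i : Fin n) :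
    Integrable (fun h : Fin n → ℝ => (a + σ * h i) ^ 2) (_root_.stdGaussian n) := by
  have hmp : MeasurePreserving (Function.eval i) (_root_.stdGaussian n) (gaussianReal 0 1) :=
    measurePreserving_eval (fun _ : Fin n => gaussianReal 0 1) i
  have hL : MemLp (fun y : ℝ => a + σ * y) 2 (gaussianReal 0 1) :=
    (memLp_const a).add ((memLp_id_gaussianReal' 2 (by simp)).const_mul σ)
  exact (hL.comp_measurePreserving hmp).integrable_sq

end Gaussian
section Risk

variable {n : ℕ} {lam : Fin n → ℝ} {γ : ℝ} {G : (Fin n → ℝ) → (Fin n → ℝ)}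

theorem dotProduct_self_nonneg_real (a : Fin n → ℝ) : 0 ≤ a ⬝ᵥ a :=
  Finset.sum_nonneg fun i _ => mul_self_nonneg (a i)

theorem sum_sub_sq_eq (a b : Fin n → ℝ) :
    ∑ i, (a i - b i) ^ 2 = a ⬝ᵥ a - 2 * (a ⬝ᵥ b) + b ⬝ᵥ b := by
  simp only [dotProduct, Finset.mul_sum, ← Finset.sum_sub_distrib, ← Finset.sum_add_distrib]
  exact Finset.sum_congr rfl fun i _ => by ring

theorem continuous_of_slopeOptimality (hG : ∀ u, SlopeOptimality lam γ u (G u)) :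
    Continuous G := by
  refine continuous_pi fun i => continuous_iff_continuousAt.mpr fun u => ?_
  refine tendsto_iff_dist_tendsto_zero.mpr ?_
  have hc : Continuous fun v : Fin n → ℝ => Real.sqrt (∑ j, (v j - u j) * (v j - u j)) := by
    fun_prop
  refine squeeze_zero (fun _ => dist_nonneg) (fun v => ?_) (by simpa using hc.tendsto u)
  rw [Real.dist_eq]
  refine Real.abs_le_sqrt ?_
  refine le_trans ?_ ((hG v).nonexpansive (hG u))
  have h := Finset.single_le_sum (f := fun j => (G v - G u) j * (G v - G u) j)
    (fun j _ => mul_self_nonneg _) (Finset.mem_univ i)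
  simpa [dotProduct, pow_two] using h

theorem dotProduct_self_le_of_slopeOptimality (hnonneg : ∀ i, 0 ≤ lam i) (hγ : 0 ≤ γ)
    (hG : ∀ u, SlopeOptimality lam γ u (G u)) (u : Fin n → ℝ) : G u ⬝ᵥ G u ≤ u ⬝ᵥ u := by
  simpa using (hG u).nonexpansive (SlopeOptimality.zero hnonneg hγ)

theorem integrable_dotProduct_self_affine (x : Fin n → ℝ) (σ : ℝ) :
    Integrable (fun h => (x + σ • h) ⬝ᵥ (x + σ • h)) (_root_.stdGaussian n) := by
  refine integrable_finsetSum _ fun i _ => ?_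
  simpa [pow_two] using integrable_sq_add_mul_stdGaussian (x i) σ i

theorem measurable_comp_affine (hG : ∀ u, SlopeOptimality lam γ u (G u)) (x : Fin n → ℝ) (σ : ℝ) :
    Measurable fun h => G (x + σ • h) :=
  ((continuous_of_slopeOptimality hG).comp (by fun_prop)).measurable

theorem measurable_dotProduct {f g : (Fin n → ℝ) → (Fin n → ℝ)} (hf : Measurable f)
    (hg : Measurable g) : Measurable fun h => f h ⬝ᵥ g h := by
  unfold dotProduct; fun_prop

theorem integrable_dotProduct_self_prox (hnonneg : ∀ i, 0 ≤ lam i) (hγ : 0 ≤ γ)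
    (hG : ∀ u, SlopeOptimality lam γ u (G u)) (x : Fin n → ℝ) (σ : ℝ) :
    Integrable (fun h => G (x + σ • h) ⬝ᵥ G (x + σ • h)) (_root_.stdGaussian n) := by
  have hm := measurable_comp_affine hG x σ
  refine (integrable_dotProduct_self_affine x σ).mono'
    (measurable_dotProduct hm hm).aestronglyMeasurable (ae_of_all _ fun h => ?_)
  rw [Real.norm_of_nonneg (dotProduct_self_nonneg_real _)]
  exact dotProduct_self_le_of_slopeOptimality hnonneg hγ hG _

theorem integrable_prox_dotProduct (hnonneg : ∀ i, 0 ≤ lam i) (hγ : 0 ≤ γ)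
    (hG : ∀ u, SlopeOptimality lam γ u (G u)) (x : Fin n → ℝ) (σ : ℝ) :
    Integrable (fun h => G (x + σ • h) ⬝ᵥ x) (_root_.stdGaussian n) := by
  have hm := measurable_comp_affine hG x σ
  refine ((integrable_dotProduct_self_prox hnonneg hγ hG x σ).add
    (integrable_const (x ⬝ᵥ x))).mono'
    (measurable_dotProduct hm measurable_const).aestronglyMeasurable (ae_of_all _ fun h => ?_)
  have h1 := dotProduct_self_nonneg_real (G (x + σ • h) - x)
  have h2 := dotProduct_self_nonneg_real (G (x + σ • h) + x)
  have h3 := dotProduct_comm x (G (x + σ • h))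
  have h4 := dotProduct_self_nonneg_real (G (x + σ • h))
  have h5 := dotProduct_self_nonneg_real x
  simp only [sub_dotProduct, dotProduct_sub, add_dotProduct, dotProduct_add] at h1 h2
  rw [Real.norm_eq_abs, Pi.add_apply]
  exact abs_le.mpr ⟨by linarith, by linarith⟩

theorem sq_le_sum_shifted_prox (hG : ∀ u, SlopeOptimality lam γ u (G u)) {u : Fin n → ℝ}
    (hu : G u ≠ 0) (K : ℝ) :
    K ^ 2 ≤ ∑ i, (G (u + Pi.single i K) ⬝ᵥ G (u + Pi.single i K)
      + G (u + Pi.single i (-K)) ⬝ᵥ G (u + Pi.single i (-K))) := by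
  have hpos : 0 < G u ⬝ᵥ G u := lt_of_le_of_ne (dotProduct_self_nonneg_real _)
    fun h => hu (dotProduct_self_eq_zero.mp h.symm)
  have key : ∀ (i : Fin n) (s : ℝ), 0 ≤ s * G u i →
      (s * G u i) ^ 2 ≤ (G (u + Pi.single i s) ⬝ᵥ G (u + Pi.single i s)) * (G u ⬝ᵥ G u) := by
    intro i s hs
    have h1 := (hG u).add_dotProduct_le (hG (u + Pi.single i s))
    rw [add_sub_cancel_left, single_dotProduct] at h1
    refine le_trans ?_ (sq_dotProduct_le _ _)
    exact pow_le_pow_left₀ hs (by linarith) 2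
  refine le_of_mul_le_mul_right ?_ hpos
  rw [Finset.sum_mul]
  nth_rewrite 1 [dotProduct]
  rw [Finset.mul_sum]
  refine Finset.sum_le_sum fun i _ => ?_
  have hp := mul_nonneg (dotProduct_self_nonneg_real (G (u + Pi.single i K))) hpos.le
  have hn := mul_nonneg (dotProduct_self_nonneg_real (G (u + Pi.single i (-K)))) hpos.le
  rcases le_total 0 (K * G u i) with h | h
  · have := key i K h
    nlinarith
  · have := key i (-K) (by linarith)
    nlinarith

theorem prox_dotProduct_add_reflect_le (hG : ∀ u, SlopeOptimality lam γ u (G u))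
    (x v : Fin n → ℝ) : (G (x + v) + G (x - v)) ⬝ᵥ x ≤ 2 * (x ⬝ᵥ x) := by
  have hneg := (hG (x - v)).neg
  have h1 := (hG (x + v)).nonexpansive hneg
  have e : x + v - -(x - v) = (2 : ℝ) • x := by
    ext i; simp; ring
  rw [sub_neg_eq_add, e, smul_dotProduct, dotProduct_smul, smul_eq_mul, smul_eq_mul] at h1
  have h2 := sq_dotProduct_le (G (x + v) + G (x - v)) x
  have hx := dotProduct_self_nonneg_real x
  refine (abs_le_of_sq_le_sq' ?_ (by linarith)).2
  nlinarith

/-- Comparing the Gaussian measure with its translates by `± K / σ` along each coordinate, the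
probability that the estimator is nonzero is controlled by its second moment, up to the
probability that the noise is very large. -/
theorem measureReal_prox_ne_zero_le (hnonneg : ∀ i, 0 ≤ lam i) (hγ : 0 ≤ γ)
    (hG : ∀ u, SlopeOptimality lam γ u (G u)) (x : Fin n → ℝ) {K σ : ℝ} (hK : 0 < K)
    (hKσ : K ≤ σ) :
    K ^ 2 * (_root_.stdGaussian n).real {h | G (x + σ • h) ≠ 0}
      ≤ 2 * n * Real.exp 2 * ∫ h, G (x + σ • h) ⬝ᵥ G (x + σ • h) ∂_root_.stdGaussian n
        + K ^ 2 * (n * (2 * Real.exp (-(σ / K) ^ 2 / 2))) := by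
  set μ := _root_.stdGaussian n with hμ
  have hσ : 0 < σ := hK.trans_le hKσ
  set A : Set (Fin n → ℝ) := {h | G (x + σ • h) ≠ 0} with hA
  set B : Set (Fin n → ℝ) := {h | ∃ i, σ / K < |h i|} with hB
  set g : (Fin n → ℝ) → ℝ := fun h => G (x + σ • h) ⬝ᵥ G (x + σ • h) with hg
  have hgm : Measurable g :=
    measurable_dotProduct (measurable_comp_affine hG x σ) (measurable_comp_affine hG x σ)
  have hg0 : ∀ h, 0 ≤ g h := fun h => dotProduct_self_nonneg_real _
  have hgI : 0 ≤ ∫ h, g h ∂μ := integral_nonneg hg0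
  have hgi : Integrable g μ := integrable_dotProduct_self_prox hnonneg hγ hG x σ
  have hAm : MeasurableSet A :=
    (measurable_comp_affine hG x σ) (measurableSet_singleton (0 : Fin n → ℝ)).compl
  have hBm : MeasurableSet B := by
    have : B = ⋃ i, {h : Fin n → ℝ | σ / K < |h i|} := by ext; simp [hB]
    rw [this]
    exact MeasurableSet.iUnion fun i => measurableSet_lt (by fun_prop) (by fun_prop)
  have hgm' : Measurable fun h => ENNReal.ofReal (g h) := hgm.ennreal_ofReal
  have hshift : ∀ (s : ℝ), |s| = K / σ → ∀ i : Fin n,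
      ∫⁻ h, {h : Fin n → ℝ | |h i| ≤ σ / K}.indicator
        (fun h => ENNReal.ofReal (g (h + Pi.single i s))) h ∂μ
      ≤ ENNReal.ofReal (Real.exp 2) * ∫⁻ h, ENNReal.ofReal (g h) ∂μ := by
    intro s hs i
    refine lintegral_stdGaussian_shift_le (f := fun h => ENNReal.ofReal (g h)) ?_ ?_ i hgm'
    · rw [hs]; exact (by field_simp : σ / K * (K / σ) = 1).le
    · rw [← sq_abs, hs]
      exact pow_le_one₀ (by positivity) ((div_le_one hσ).mpr hKσ)
  have hpoint : ∀ h, (A \ B).indicator (fun _ => ENNReal.ofReal (K ^ 2)) h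
      ≤ ∑ i, ({h : Fin n → ℝ | |h i| ≤ σ / K}.indicator
          (fun h => ENNReal.ofReal (g (h + Pi.single i (K / σ)))) h
        + {h : Fin n → ℝ | |h i| ≤ σ / K}.indicator
          (fun h => ENNReal.ofReal (g (h + Pi.single i (-(K / σ))))) h) := by
    intro h
    by_cases hh : h ∈ A \ B
    · have hmem : ∀ i, h ∈ {h : Fin n → ℝ | |h i| ≤ σ / K} := fun i =>
        not_lt.mp fun hlt => hh.2 ⟨i, hlt⟩
      simp only [Set.indicator_of_mem hh, Set.indicator_of_mem (hmem _)]
      simp only [← ENNReal.ofReal_add (hg0 _) (hg0 _)]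
      rw [← ENNReal.ofReal_sum_of_nonneg fun i _ => add_nonneg (hg0 _) (hg0 _)]
      refine ENNReal.ofReal_le_ofReal
        ((sq_le_sum_shifted_prox hG (u := x + σ • h) hh.1 K).trans_eq ?_)
      have e : ∀ (i : Fin n) (s : ℝ),
          x + σ • h + Pi.single i s = x + σ • (h + Pi.single i (s / σ)) := by
        intro i s
        rw [smul_add, ← Pi.single_smul, smul_eq_mul, mul_div_cancel₀ _ hσ.ne', add_assoc]
      refine Finset.sum_congr rfl fun i _ => ?_
      rw [e, e, neg_div]
    · rw [Set.indicator_of_notMem hh]; exact zero_le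
  have hmeas : ∀ (s : ℝ) (i : Fin n), Measurable ({h : Fin n → ℝ | |h i| ≤ σ / K}.indicator
      fun h => ENNReal.ofReal (g (h + Pi.single i s))) := fun s i =>
    (hgm'.comp (measurable_id.add_const _)).indicator
      (measurableSet_le (by fun_prop) (by fun_prop))
  have hint := lintegral_mono (μ := μ) hpoint
  rw [lintegral_indicator_const (hAm.diff hBm),
    lintegral_finsetSum _ fun i _ => by
      exact (hmeas (K / σ) i).add (hmeas (-(K / σ)) i)] at hint
  have hbound : ENNReal.ofReal (K ^ 2) * μ (A \ B)
      ≤ ENNReal.ofReal (2 * n * Real.exp 2 * ∫ h, g h ∂μ) := by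
    refine hint.trans ((Finset.sum_le_sum fun i _ => ?_ : _ ≤ ∑ _i : Fin n,
      ENNReal.ofReal (2 * Real.exp 2 * ∫ h, g h ∂μ)).trans_eq ?_)
    · rw [lintegral_add_left (hmeas _ i)]
      have h1 := hshift (K / σ) (abs_of_pos (by positivity)) i
      have h2 := hshift (-(K / σ)) (by rw [abs_neg, abs_of_pos (by positivity)]) i
      rw [← ofReal_integral_eq_lintegral_ofReal hgi (ae_of_all _ hg0),
        ← ENNReal.ofReal_mul (Real.exp_nonneg _)] at h1 h2
      have hI : 0 ≤ Real.exp 2 * ∫ h, g h ∂μ :=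
        mul_nonneg (Real.exp_nonneg _) hgI
      refine (add_le_add h1 h2).trans_eq ?_
      rw [← ENNReal.ofReal_add hI hI]
      congr 1; ring
    · rw [← ENNReal.ofReal_sum_of_nonneg fun _ _ => by positivity]
      congr 1
      simp
      ring
  have hreal : K ^ 2 * μ.real (A \ B) ≤ 2 * n * Real.exp 2 * ∫ h, g h ∂μ := by
    have h0 : 0 ≤ 2 * n * Real.exp 2 * ∫ h, g h ∂μ := by positivity
    have := ENNReal.toReal_mono ENNReal.ofReal_ne_top hbound
    rwa [ENNReal.toReal_mul, ENNReal.toReal_ofReal (sq_nonneg K), ENNReal.toReal_ofReal h0] at this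
  have htail : μ.real B ≤ n * (2 * Real.exp (-(σ / K) ^ 2 / 2)) :=
    stdGaussian_exists_abs_gt_le (by positivity)
  have hsplit : μ.real A ≤ μ.real (A \ B) + μ.real B :=
    (measureReal_mono (by intro h hh; by_cases hb : h ∈ B <;> simp [hh, hb])).trans
      (measureReal_union_le _ _)
  calc K ^ 2 * μ.real A ≤ K ^ 2 * (μ.real (A \ B) + μ.real B) :=
        mul_le_mul_of_nonneg_left hsplit (sq_nonneg K)
    _ = K ^ 2 * μ.real (A \ B) + K ^ 2 * μ.real B := mul_add _ _ _
    _ ≤ _ := add_le_add hreal (mul_le_mul_of_nonneg_left htail (sq_nonneg K))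

theorem integral_prox_dotProduct_le (hnonneg : ∀ i, 0 ≤ lam i) (hγ : 0 ≤ γ)
    (hG : ∀ u, SlopeOptimality lam γ u (G u)) (x : Fin n → ℝ) (σ : ℝ) :
    2 * ∫ h, G (x + σ • h) ⬝ᵥ x ∂_root_.stdGaussian n
      ≤ 4 * (x ⬝ᵥ x) * (_root_.stdGaussian n).real {h | G (x + σ • h) ≠ 0} := by
  set μ := _root_.stdGaussian n with hμ
  set A : Set (Fin n → ℝ) := {h | G (x + σ • h) ≠ 0} with hA
  have hAm : MeasurableSet A :=
    (measurable_comp_affine hG x σ) (measurableSet_singleton (0 : Fin n → ℝ)).compl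
  have hmp : MeasurePreserving (fun h : Fin n → ℝ => -h) μ μ := measurePreserving_neg_stdGaussian n
  have hemb : MeasurableEmbedding fun h : Fin n → ℝ => -h :=
    (MeasurableEquiv.neg (Fin n → ℝ)).measurableEmbedding
  have hi : Integrable (fun h => G (x + σ • h) ⬝ᵥ x) μ :=
    integrable_prox_dotProduct hnonneg hγ hG x σ
  have hi' : Integrable (fun h => G (x + σ • -h) ⬝ᵥ x) μ := hmp.integrable_comp_of_integrable hi
  have hs : ∫ h, G (x + σ • -h) ⬝ᵥ x ∂μ = ∫ h, G (x + σ • h) ⬝ᵥ x ∂μ :=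
    hmp.integral_comp hemb (fun h => G (x + σ • h) ⬝ᵥ x)
  have hj : Integrable (A.indicator fun _ => 2 * (x ⬝ᵥ x)) μ := (integrable_const _).indicator hAm
  have hj' : Integrable (fun h => A.indicator (fun _ => 2 * (x ⬝ᵥ x)) (-h)) μ :=
    hmp.integrable_comp_of_integrable hj
  have hsj : ∫ h, A.indicator (fun _ => 2 * (x ⬝ᵥ x)) (-h) ∂μ
      = ∫ h, A.indicator (fun _ => 2 * (x ⬝ᵥ x)) h ∂μ :=
    hmp.integral_comp hemb (A.indicator fun _ => 2 * (x ⬝ᵥ x))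
  have hX : 0 ≤ 2 * (x ⬝ᵥ x) := mul_nonneg zero_le_two (dotProduct_self_nonneg_real x)
  have hmono := integral_mono (hi.add hi') (hj.add hj') fun h => by
    simp only [Pi.add_apply]
    have hle := prox_dotProduct_add_reflect_le hG x (σ • h)
    rw [add_dotProduct, sub_eq_add_neg x, ← smul_neg] at hle
    have hnn : ∀ h, 0 ≤ A.indicator (fun _ => 2 * (x ⬝ᵥ x)) h :=
      Set.indicator_nonneg fun _ _ => hX
    by_cases h1 : h ∈ A
    · rw [Set.indicator_of_mem h1]; linarith [hnn (-h)]
    by_cases h2 : -h ∈ A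
    · rw [Set.indicator_of_mem h2]; linarith [hnn h]
    · rw [Set.indicator_of_notMem h1, Set.indicator_of_notMem h2, not_not.mp h1, not_not.mp h2]
      simp
  rw [integral_add' hi hi', integral_add' hj hj', hs, hsj, integral_indicator_const _ hAm,
    smul_eq_mul] at hmono
  linarith

theorem le_prox_risk (hnonneg : ∀ i, 0 ≤ lam i) (hγ : 0 ≤ γ)
    (hG : ∀ u, SlopeOptimality lam γ u (G u)) (x : Fin n → ℝ) {K σ : ℝ} (hK : 0 < K)
    (hK2 : K ^ 2 = 8 * n * Real.exp 2 * (x ⬝ᵥ x)) (hn : 0 < n) (hKσ : K ≤ σ) :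
    x ⬝ᵥ x - 8 * (x ⬝ᵥ x) * n * Real.exp (-(σ / K) ^ 2 / 2)
      ≤ ∫ h, ∑ i, (G (x + σ • h) i - x i) ^ 2 ∂_root_.stdGaussian n := by
  have hg := integrable_dotProduct_self_prox hnonneg hγ hG x σ
  have hd := integrable_prox_dotProduct hnonneg hγ hG x σ
  have h1 := measureReal_prox_ne_zero_le hnonneg hγ hG x hK hKσ
  have h2 := integral_prox_dotProduct_le hnonneg hγ hG x σ
  simp only [sum_sub_sq_eq]
  rw [integral_add (by exact hg.sub (hd.const_mul 2)) (integrable_const _),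
    integral_sub hg (hd.const_mul 2), integral_const_mul]
  simp only [integral_const, probReal_univ, one_smul]
  rw [hK2] at h1
  have hn' : (0 : ℝ) < n := Nat.cast_pos.mpr hn
  have hc : 0 < 2 * n * Real.exp 2 := by positivity
  have h3 : 4 * (x ⬝ᵥ x) * (_root_.stdGaussian n).real {h | G (x + σ • h) ≠ 0}
      ≤ (∫ h, G (x + σ • h) ⬝ᵥ G (x + σ • h) ∂_root_.stdGaussian n)
        + 8 * (x ⬝ᵥ x) * n * Real.exp (-(σ / K) ^ 2 / 2) := by
    refine le_of_mul_le_mul_left ?_ hc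
    linarith
  linarith

theorem tendsto_prox_risk (hlam : Antitone lam) (hnonneg : ∀ i, 0 ≤ lam i) (i₀ : Fin n)
    (hpos : 0 < lam i₀) {η : ℝ → (Fin n → ℝ) → (Fin n → ℝ)}
    (hη : ∀ γ u, 0 ≤ γ → SlopeOptimality lam γ u (η γ u)) (x : Fin n → ℝ) {σ : ℝ} (hσ : 0 < σ) :
    Tendsto (fun χ => ∫ h, ∑ i, (η (σ * χ) (x + σ • h) i - x i) ^ 2 ∂_root_.stdGaussian n)
      atTop (nhds (x ⬝ᵥ x)) := by
  have hconst : x ⬝ᵥ x = ∫ _h, x ⬝ᵥ x ∂_root_.stdGaussian n := by simp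
  rw [hconst]
  refine tendsto_integral_filter_of_dominated_convergence
    (fun h => 2 * ((x + σ • h) ⬝ᵥ (x + σ • h)) + 2 * (x ⬝ᵥ x)) ?_ ?_ ?_ ?_
  · filter_upwards [eventually_ge_atTop 0] with χ hχ
    have hm := measurable_comp_affine (fun u => hη (σ * χ) u (by positivity)) x σ
    simp only [sum_sub_sq_eq]
    exact (((measurable_dotProduct hm hm).sub
      ((measurable_dotProduct hm measurable_const).const_mul 2)).add_const _).aestronglyMeasurable
  · filter_upwards [eventually_ge_atTop 0] with χ hχ
    refine ae_of_all _ fun h => ?_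
    have hγ : 0 ≤ σ * χ := by positivity
    have h1 := dotProduct_self_le_of_slopeOptimality hnonneg hγ (fun u => hη (σ * χ) u hγ)
      (x + σ • h)
    have h2 := dotProduct_self_nonneg_real (η (σ * χ) (x + σ • h) + x)
    have h3 := dotProduct_comm x (η (σ * χ) (x + σ • h))
    simp only [add_dotProduct _ x, dotProduct_add _ _ x] at h2
    rw [Real.norm_of_nonneg (Finset.sum_nonneg fun i _ => sq_nonneg _), sum_sub_sq_eq]
    linarith
  · exact ((integrable_dotProduct_self_affine x σ).const_mul 2).add (integrable_const _)
  · refine ae_of_all _ fun h => tendsto_const_nhds.congr' ?_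
    filter_upwards [eventually_ge_atTop 0,
      eventually_ge_atTop ((∑ i, |(x + σ • h) i|) / (σ * lam i₀))] with χ hχ hχ'
    have hγ : 0 ≤ σ * χ := by positivity
    have hle : ∑ i, |(x + σ • h) i| ≤ σ * χ * lam i₀ := by
      rw [div_le_iff₀ (by positivity)] at hχ'
      linarith
    have h0 := (hη (σ * χ) (x + σ • h) hγ).unique
      (SlopeOptimality.zero_of_sum_abs_le hlam hnonneg hγ i₀ hle)
    simp [h0, dotProduct, pow_two]

end Risk

/-- in the large noise regime, the optimally tuned asymptotic MSE of
SLOPE satisfies `δ(σ*(σ_z)² − σ_z²) = ‖x‖₂²/p + O(exp(−c σ_z²))` as `σ_z → ∞`. -/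
theorem slope_large_noise_sensitivity
    (p : ℕ) (hp : 1 ≤ p)
    (lam : Fin p → ℝ)
    (hmono : ∀ i j : Fin p, i ≤ j → lam j ≤ lam i)
    (hnonneg : ∀ i, 0 ≤ lam i)
    (hlam1 : 0 < lam ⟨0, hp⟩)
    (hlam_le : lam ⟨0, hp⟩ ≤ 1)
    (x : Fin p → ℝ) (hx : x ≠ 0)
    (δ : ℝ) (hδ : 0 < δ)
    (ηp : ℝ → (Fin p → ℝ) → (Fin p → ℝ))
    (hηp : ∀ γ u, 0 ≤ γ → IsSlopeProx lam γ u (ηp γ u))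
    (σs : ℝ → ℝ)
    (hσs : ∀ σz : ℝ, 0 < σz → 0 < σs σz ∧
      (σs σz) ^ 2 = σz ^ 2 + (1 / (δ * (p : ℝ))) * sInf {m : ℝ | ∃ χ : ℝ, 0 < χ ∧
        m = ∫ h, (∑ i, (ηp (σs σz * χ) (fun j => x j + σs σz * h j) i - x i) ^ 2)
          ∂ stdGaussian p}) :
    ∃ C : ℝ, 0 < C ∧ ∃ c : ℝ, 0 < c ∧ ∃ σ0 : ℝ, 0 < σ0 ∧
      ∀ σz : ℝ, σ0 ≤ σz →
        |δ * ((σs σz) ^ 2 - σz ^ 2) - (∑ i, (x i) ^ 2) / (p : ℝ)|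
          ≤ C * Real.exp (-c * σz ^ 2) := by
  have hlam : Antitone lam := fun i j hij => hmono i j hij
  have hη : ∀ γ u, 0 ≤ γ → SlopeOptimality lam γ u (ηp γ u) := fun γ u hγ =>
    (hηp γ u hγ).optimality hlam hnonneg hγ
  have hp' : (0 : ℝ) < p := Nat.cast_pos.mpr hp
  set X := x ⬝ᵥ x with hXdef
  have hX : 0 < X := lt_of_le_of_ne (dotProduct_self_nonneg_real _)
    fun h => hx (dotProduct_self_eq_zero.mp h.symm)
  have hXsum : ∑ i, (x i) ^ 2 = X := by simp [hXdef, dotProduct, pow_two]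
  set K := Real.sqrt (8 * p * Real.exp 2 * X) with hKdef
  have hK : 0 < K := Real.sqrt_pos.mpr (by positivity)
  have hK2 : K ^ 2 = 8 * p * Real.exp 2 * X := Real.sq_sqrt (by positivity)
  refine ⟨8 * X, by positivity, 1 / (2 * K ^ 2), by positivity, K, hK, fun σz hσz => ?_⟩
  have hσz0 : 0 < σz := hK.trans_le hσz
  obtain ⟨hσ, hfix⟩ := hσs σz hσz0
  set σ := σs σz with hσdef
  set S : Set ℝ := {m : ℝ | ∃ χ : ℝ, 0 < χ ∧
        m = ∫ h, (∑ i, (ηp (σ * χ) (fun j => x j + σ * h j) i - x i) ^ 2)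
          ∂ stdGaussian p} with hS
  have hS0 : ∀ m ∈ S, 0 ≤ m := by
    rintro m ⟨χ, -, rfl⟩
    exact integral_nonneg fun h => Finset.sum_nonneg fun i _ => sq_nonneg _
  have hSne : S.Nonempty := ⟨_, 1, one_pos, rfl⟩
  have hinf0 : 0 ≤ sInf S := Real.sInf_nonneg hS0
  have hle : σz ≤ σ := by
    refine le_of_sq_le_sq ?_ hσ.le
    rw [hfix]
    have : 0 ≤ 1 / (δ * (p : ℝ)) * sInf S := by positivity
    linarith
  have hupper : sInf S ≤ X := by
    refine ge_of_tendsto (tendsto_prox_risk hlam hnonneg ⟨0, hp⟩ hlam1 hη x hσ) ?_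
    filter_upwards [eventually_gt_atTop 0] with χ hχ
    exact csInf_le ⟨0, hS0⟩ ⟨χ, hχ, rfl⟩
  have hlower : X - 8 * X * p * Real.exp (-(σ / K) ^ 2 / 2) ≤ sInf S := by
    refine le_csInf hSne ?_
    rintro m ⟨χ, hχ, rfl⟩
    have hγ : 0 ≤ σ * χ := by positivity
    exact le_prox_risk hnonneg hγ (fun u => hη _ u hγ) x hK hK2 hp (hσz.trans hle)
  have hexp : Real.exp (-(σ / K) ^ 2 / 2) ≤ Real.exp (-(1 / (2 * K ^ 2)) * σz ^ 2) := by
    refine Real.exp_le_exp.mpr ?_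
    have hsq : σz ^ 2 ≤ σ ^ 2 := pow_le_pow_left₀ hσz0.le hle 2
    have e : -(σ / K) ^ 2 / 2 = -(1 / (2 * K ^ 2)) * σ ^ 2 := by field_simp
    rw [e]
    exact mul_le_mul_of_nonpos_left hsq (neg_nonpos.mpr (by positivity))
  have heq : δ * (σ ^ 2 - σz ^ 2) - (∑ i, (x i) ^ 2) / (p : ℝ) = -((X - sInf S) / p) := by
    rw [hfix, hXsum]; field_simp; ring
  rw [heq, abs_neg, abs_of_nonneg (div_nonneg (by linarith) hp'.le), div_le_iff₀ hp']
  have := mul_le_mul_of_nonneg_left hexp (by positivity : 0 ≤ 8 * X * p)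
  linarith
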